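/- Let A ∈ ℝ^{m×n}, b ∈ ℝ^m, ζ > 0, ρ > 0, μ := λ_min(AᵀA), L_g := λ_max(AᵀA). Let (x, y, λ) ∈ ℝⁿ×ℝⁿ×ℝⁿ with λ = Aᵀ(Ay − b), and let (x⁺, y⁺, λ⁺) be obtained by one ADMM step: x⁺ a global minimizer of x' ↦ Φ(x') + (ρ/2)‖x' − y + λ/ρ‖_2²; y⁺ the minimizer of y' ↦ g(y') + (ρ/2)‖y' − x⁺ − λ/ρ‖_2²; λ⁺ = λ + ρ(x⁺ − y⁺). Define the merit function L_m(x', y') := Φ(x') + g(x') + (ρ/2)‖x' − y'‖_2². Then L_m(x⁺, y⁺) ≤ L_m(x, y) − κ̃₁‖y⁺ − y‖_2², where κ̃₁ := (μ + ρ)/2 − (2ρL_g² + L_g³)/(2ρ²). In particular κ̃₁ > 0 whenever μ > (L_g³ + 2L_g²ρ − ρ³)/ρ². -/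

import Mathlib

/-- The set of (real) eigenvalues of a square matrix `M`. -/
def eigSet {n : ℕ} (M : Matrix (Fin n) (Fin n) ℝ) : Set ℝ :=
  {t : ℝ | ∃ v : Fin n → ℝ, v ≠ 0 ∧ M.mulVec v = t • v}

/-- `Φ(x) = ζ ‖x‖_{1/2}^{1/2}/‖x‖_2^{1/2}` for `x ≠ 0`, and `Φ(0) = ζ`. -/
noncomputable def Phi {n : ℕ} (ζ : ℝ) (x : Fin n → ℝ) : ℝ :=
  if x = 0 then ζ
  else ζ * (∑ i, |x i| ^ ((1 : ℝ)/2)) / (∑ i, (x i) ^ 2) ^ ((1 : ℝ)/4)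

/-- `g(y) = ½‖Ay − b‖₂²`. -/
noncomputable def gobj {m n : ℕ} (A : Matrix (Fin m) (Fin n) ℝ) (b : Fin m → ℝ)
    (y : Fin n → ℝ) : ℝ :=
  (1/2) * ∑ j, (A.mulVec y j - b j) ^ 2

/-- The merit function `L_m(x, y) = Φ(x) + g(x) + (ρ/2)‖x − y‖₂²`. -/
noncomputable def merit {m n : ℕ} (A : Matrix (Fin m) (Fin n) ℝ) (b : Fin m → ℝ)
    (ζ ρ : ℝ) (x y : Fin n → ℝ) : ℝ :=
  Phi ζ x + gobj A b x + (ρ/2) * ∑ i, (x i - y i) ^ 2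

open Matrix in
theorem aux_gobj_add {m n : ℕ} (A : Matrix (Fin m) (Fin n) ℝ) (b : Fin m → ℝ)
    (y v : Fin n → ℝ) :
    gobj A b (y + v) = gobj A b y + (Aᵀ *ᵥ (A *ᵥ y - b)) ⬝ᵥ v
      + (1/2) * ((A *ᵥ v) ⬝ᵥ (A *ᵥ v)) := by
  have h : (Aᵀ *ᵥ (A *ᵥ y - b)) ⬝ᵥ v = (A *ᵥ y - b) ⬝ᵥ (A *ᵥ v) := by
    rw [Matrix.mulVec_transpose, Matrix.dotProduct_mulVec]
  rw [h]
  unfold gobj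
  simp only [Matrix.mulVec_add, dotProduct, Pi.add_apply, Pi.sub_apply, Finset.mul_sum]
  rw [← Finset.sum_add_distrib, ← Finset.sum_add_distrib]
  exact Finset.sum_congr rfl fun i _ => by ring

open Matrix in
theorem aux_sq_add {n : ℕ} (u v : Fin n → ℝ) :
    ∑ i, (u i + v i) ^ 2 = u ⬝ᵥ u + 2 * (u ⬝ᵥ v) + v ⬝ᵥ v := by
  simp only [dotProduct, Finset.mul_sum]
  rw [← Finset.sum_add_distrib, ← Finset.sum_add_distrib]
  exact Finset.sum_congr rfl fun i _ => by ring

open Matrix in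
theorem aux_nonneg {n : ℕ} (u : Fin n → ℝ) : 0 ≤ u ⬝ᵥ u :=
  Finset.sum_nonneg fun i _ => mul_self_nonneg (u i)

open Matrix in
theorem aux_psd {n : ℕ} (M : Matrix (Fin n) (Fin n) ℝ) (hM : M.IsHermitian)
    (h : ∀ e ∈ eigSet M, 0 ≤ e) (v : Fin n → ℝ) : 0 ≤ v ⬝ᵥ (M *ᵥ v) := by
  have hp : M.PosSemidef := by
    rw [hM.posSemidef_iff_eigenvalues_nonneg]
    intro i
    refine h _ ⟨hM.eigenvectorBasis i, ?_, hM.mulVec_eigenvectorBasis i⟩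
    intro h0
    apply hM.eigenvectorBasis.orthonormal.ne_zero i
    ext j
    exact congrFun h0 j
  simpa using hp.dotProduct_mulVec_nonneg v

open Matrix in
theorem aux_herm {m n : ℕ} (A : Matrix (Fin m) (Fin n) ℝ) : (Aᵀ * A).IsHermitian := by
  simp [Matrix.IsHermitian, Matrix.conjTranspose_eq_transpose_of_trivial]

open Matrix in
theorem aux_form {m n : ℕ} (A : Matrix (Fin m) (Fin n) ℝ) (v : Fin n → ℝ) :
    v ⬝ᵥ ((Aᵀ * A) *ᵥ v) = (A *ᵥ v) ⬝ᵥ (A *ᵥ v) := by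
  rw [← Matrix.mulVec_mulVec, Matrix.dotProduct_mulVec, Matrix.vecMul_transpose]

open Matrix in
theorem aux_lower {m n : ℕ} (A : Matrix (Fin m) (Fin n) ℝ) (μ : ℝ)
    (hμ : IsLeast (eigSet (Aᵀ * A)) μ) (v : Fin n → ℝ) :
    μ * (v ⬝ᵥ v) ≤ (A *ᵥ v) ⬝ᵥ (A *ᵥ v) := by
  have := aux_psd (Aᵀ * A - μ • 1) (by
    refine (aux_herm A).sub ?_
    simp [Matrix.IsHermitian, Matrix.conjTranspose_smul]) (by
    rintro e ⟨w, hw, he⟩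
    have : e + μ ∈ eigSet (Aᵀ * A) := by
      refine ⟨w, hw, ?_⟩
      rw [Matrix.sub_mulVec, Matrix.smul_mulVec, Matrix.one_mulVec, sub_eq_iff_eq_add] at he
      rw [he, add_smul]
    linarith [hμ.2 this]) v
  rw [Matrix.sub_mulVec, Matrix.smul_mulVec, Matrix.one_mulVec, dotProduct_sub, aux_form,
    dotProduct_smul, smul_eq_mul] at this
  linarith

open Matrix in
theorem aux_upper {m n : ℕ} (A : Matrix (Fin m) (Fin n) ℝ) (L : ℝ)
    (hL : IsGreatest (eigSet (Aᵀ * A)) L) (v : Fin n → ℝ) :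
    (A *ᵥ v) ⬝ᵥ (A *ᵥ v) ≤ L * (v ⬝ᵥ v) := by
  have := aux_psd (L • 1 - Aᵀ * A) (by
    refine Matrix.IsHermitian.sub ?_ (aux_herm A)
    simp [Matrix.IsHermitian, Matrix.conjTranspose_smul]) (by
    rintro e ⟨w, hw, he⟩
    have : L - e ∈ eigSet (Aᵀ * A) := by
      refine ⟨w, hw, ?_⟩
      rw [Matrix.sub_mulVec, Matrix.smul_mulVec, Matrix.one_mulVec] at he
      rw [sub_smul, ← he]
      abel
    linarith [hL.2 this]) v
  rw [Matrix.sub_mulVec, Matrix.smul_mulVec, Matrix.one_mulVec, dotProduct_sub, aux_form,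
    dotProduct_smul, smul_eq_mul] at this
  linarith

open Matrix in
theorem aux_L_nonneg {m n : ℕ} (A : Matrix (Fin m) (Fin n) ℝ) (L : ℝ)
    (hL : IsGreatest (eigSet (Aᵀ * A)) L) : 0 ≤ L := by
  obtain ⟨w, hw, he⟩ := hL.1
  have h1 := aux_form A w
  rw [he, dotProduct_smul, smul_eq_mul] at h1
  have h2 := aux_nonneg (A *ᵥ w)
  have h3 : 0 < w ⬝ᵥ w :=
    lt_of_le_of_ne (aux_nonneg w) fun h => hw (dotProduct_self_eq_zero.1 h.symm)
  by_contra hneg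
  nlinarith [mul_pos (neg_pos.2 (not_le.1 hneg)) h3]

open Matrix in
theorem aux_upperT {m n : ℕ} (A : Matrix (Fin m) (Fin n) ℝ) (L : ℝ)
    (hL : IsGreatest (eigSet (Aᵀ * A)) L) (u : Fin m → ℝ) :
    (Aᵀ *ᵥ u) ⬝ᵥ (Aᵀ *ᵥ u) ≤ L * (u ⬝ᵥ u) := by
  set w := Aᵀ *ᵥ u with hw
  have h1 : w ⬝ᵥ w = u ⬝ᵥ (A *ᵥ w) := by
    conv_lhs => rw [hw]
    rw [Matrix.mulVec_transpose, Matrix.dotProduct_mulVec, ← Matrix.mulVec_transpose]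
  have h2 : (u ⬝ᵥ (A *ᵥ w)) ^ 2 ≤ (u ⬝ᵥ u) * ((A *ᵥ w) ⬝ᵥ (A *ᵥ w)) := by
    have := Finset.sum_mul_sq_le_sq_mul_sq Finset.univ u (A *ᵥ w)
    simpa [dotProduct, pow_two] using this
  have h3 := aux_upper A L hL w
  have h4 := aux_nonneg u
  have h5 := aux_nonneg w
  have h6 := aux_L_nonneg A L hL
  rw [← h1] at h2
  rcases h5.eq_or_lt with h | h
  · rw [← h]; positivity
  · have := mul_le_mul_of_nonneg_left h3 h4
    by_contra hc
    push Not at hc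
    nlinarith [mul_lt_mul_of_pos_right hc h]

open Matrix in
theorem aux_main (m n : ℕ) (A : Matrix (Fin m) (Fin n) ℝ)
    (b : Fin m → ℝ) (ζ ρ μ L : ℝ) (hζ : 0 < ζ) (hρ : 0 < ρ)
    (hμ : IsLeast (eigSet (A.transpose * A)) μ)
    (hL : IsGreatest (eigSet (A.transpose * A)) L)
    (x y lam xp yp lamp : Fin n → ℝ)
    (hlam : lam = A.transpose.mulVec (A.mulVec y - b))
    (hxp : ∀ x' : Fin n → ℝ,
      Phi ζ xp + (ρ/2) * ∑ i, (xp i - y i + lam i / ρ) ^ 2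
        ≤ Phi ζ x' + (ρ/2) * ∑ i, (x' i - y i + lam i / ρ) ^ 2)
    (hyp : ∀ y' : Fin n → ℝ,
      gobj A b yp + (ρ/2) * ∑ i, (yp i - xp i - lam i / ρ) ^ 2
        ≤ gobj A b y' + (ρ/2) * ∑ i, (y' i - xp i - lam i / ρ) ^ 2)
    (hlamp : lamp = lam + ρ • (xp - yp)) :
    merit A b ζ ρ xp yp
        ≤ merit A b ζ ρ x y
          - ((μ + ρ)/2 - (2 * ρ * L ^ 2 + L ^ 3) / (2 * ρ ^ 2)) * ∑ i, (yp i - y i) ^ 2 ∧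
      (μ > (L ^ 3 + 2 * L ^ 2 * ρ - ρ ^ 3) / ρ ^ 2 →
        0 < (μ + ρ)/2 - (2 * ρ * L ^ 2 + L ^ 3) / (2 * ρ ^ 2)) := by
  have hL0 := aux_L_nonneg A L hL
  set d : Fin n → ℝ := yp - y with hd
  set u := A *ᵥ d with hu
  set h := Aᵀ *ᵥ u with hh
  -- optimality of the y-step
  have hopt : Aᵀ *ᵥ (A *ᵥ yp - b) + ρ • (yp - xp) - lam = 0 := by
    set r := Aᵀ *ᵥ (A *ᵥ yp - b) + ρ • (yp - xp) - lam with hr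
    have key : ∀ t : ℝ, 0 ≤ t * (r ⬝ᵥ r) + t ^ 2 * ((1/2) * ((A *ᵥ r) ⬝ᵥ (A *ᵥ r))
        + (ρ/2) * (r ⬝ᵥ r)) := by
      intro t
      have h1 := hyp (yp + t • r)
      rw [aux_gobj_add] at h1
      have h2 : ∑ i, ((yp + t • r) i - xp i - lam i / ρ) ^ 2 =
          ∑ i, (yp i - xp i - lam i / ρ) ^ 2
            + (2 * t / ρ) * ((ρ • (yp - xp) - lam) ⬝ᵥ r) + t ^ 2 * (r ⬝ᵥ r) := by
        simp only [dotProduct, Finset.mul_sum]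
        rw [← Finset.sum_add_distrib, ← Finset.sum_add_distrib]
        refine Finset.sum_congr rfl fun i _ => ?_
        simp only [Pi.add_apply, Pi.sub_apply, Pi.smul_apply, smul_eq_mul]
        field_simp
        ring
      have h3 : r ⬝ᵥ r = (Aᵀ *ᵥ (A *ᵥ yp - b)) ⬝ᵥ r + (ρ • (yp - xp) - lam) ⬝ᵥ r := by
        rw [← add_dotProduct, ← add_sub_assoc]
      rw [h2] at h1
      simp only [Matrix.mulVec_smul, dotProduct_smul, smul_dotProduct, smul_eq_mul] at h1
      have h4 : ρ / 2 * (2 * t / ρ * ((ρ • (yp - xp) - lam) ⬝ᵥ r))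
          = t * ((ρ • (yp - xp) - lam) ⬝ᵥ r) := by
        field_simp
      nlinarith [h1, h3, h4, congrArg (fun z => t * z) h3]
    have hrr : r ⬝ᵥ r = 0 := by
      have hn := aux_nonneg r
      have hc := aux_nonneg (A *ᵥ r)
      set C := (1/2) * ((A *ᵥ r) ⬝ᵥ (A *ᵥ r)) + (ρ/2) * (r ⬝ᵥ r) with hC
      have hCn : 0 ≤ C := by positivity
      have := key (-(r ⬝ᵥ r) / (C + 1) / 1)
      by_contra hne
      have hp : 0 < r ⬝ᵥ r := lt_of_le_of_ne hn (Ne.symm hne)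
      have e : -(r ⬝ᵥ r) / (C + 1) / 1 * (r ⬝ᵥ r) + (-(r ⬝ᵥ r) / (C + 1) / 1) ^ 2 * C
          = - ((r ⬝ᵥ r) ^ 2 / (C + 1) ^ 2) := by
        field_simp
        ring
      rw [e] at this
      have : 0 < (r ⬝ᵥ r) ^ 2 / (C + 1) ^ 2 := by positivity
      linarith
    exact dotProduct_self_eq_zero.1 hrr
  have hx : ρ • (xp - yp) = h := by
    have : h = Aᵀ *ᵥ (A *ᵥ yp - b) - lam := by
      rw [hh, hu, hd, hlam, ← Matrix.mulVec_sub, Matrix.mulVec_sub]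
      congr 1
      abel
    rw [this, eq_comm, ← sub_eq_zero, ← hopt]
    rw [smul_sub, smul_sub]; abel
  have hxi : xp = yp + (1/ρ) • h := by
    rw [← hx, smul_smul, one_div, inv_mul_cancel₀ hρ.ne', one_smul]; abel
  constructor
  · have h1 := hxp x
    have e : ∀ z : Fin n → ℝ, (ρ/2) * ∑ i, (z i - y i + lam i / ρ) ^ 2
        = (ρ/2) * ∑ i, (z i - y i) ^ 2 + lam ⬝ᵥ (z - y) + (1/(2*ρ)) * (lam ⬝ᵥ lam) := by
      intro z
      simp only [dotProduct, Finset.mul_sum]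
      rw [← Finset.sum_add_distrib, ← Finset.sum_add_distrib]
      refine Finset.sum_congr rfl fun i _ => ?_
      simp only [Pi.sub_apply]
      field_simp
      ring
    rw [e, e] at h1
    have g1 := aux_gobj_add A b y (x - y)
    have g2 := aux_gobj_add A b y (xp - y)
    rw [← hlam, add_sub_cancel] at g1 g2
    have hw : xp - y = d + (1/ρ) • h := by rw [hxi, hd]; abel
    have s1 : ∑ i, (xp i - y i) ^ 2
        = d ⬝ᵥ d + 2 * (1/ρ * (u ⬝ᵥ u)) + 1/ρ * (1/ρ * (h ⬝ᵥ h)) := by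
      have := aux_sq_add d ((1/ρ) • h)
      simp only [← Pi.add_apply, ← hw] at this
      simp only [dotProduct_smul, smul_dotProduct, smul_eq_mul] at this
      rw [show d ⬝ᵥ h = u ⬝ᵥ u by rw [← aux_form, ← Matrix.mulVec_mulVec]] at this
      exact this
    have s2 : ∑ i, (xp i - yp i) ^ 2 = 1/ρ * (1/ρ * (h ⬝ᵥ h)) := by
      have := aux_sq_add 0 ((1/ρ) • h)
      simp only [dotProduct_smul, smul_dotProduct, smul_eq_mul, zero_dotProduct] at this
      rw [hxi]
      simpa using this
    have s3 : ∑ i, (yp i - y i) ^ 2 = d ⬝ᵥ d := by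
      simp [dotProduct, hd, pow_two]
    have s4 : (A *ᵥ (xp - y)) ⬝ᵥ (A *ᵥ (xp - y))
        = u ⬝ᵥ u + 2 * (1/ρ * (h ⬝ᵥ h)) + 1/ρ * (1/ρ * ((A *ᵥ h) ⬝ᵥ (A *ᵥ h))) := by
      have e1 : u ⬝ᵥ (A *ᵥ h) = h ⬝ᵥ h := by
        rw [Matrix.dotProduct_mulVec, ← Matrix.mulVec_transpose]
      rw [hw, Matrix.mulVec_add, Matrix.mulVec_smul, ← hu]
      simp only [add_dotProduct, dotProduct_add, dotProduct_smul, smul_dotProduct, smul_eq_mul]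
      rw [dotProduct_comm (A *ᵥ h) u, e1]
      ring
    have b0 := aux_lower A μ hμ d
    have b1 := aux_upper A L hL d
    have b2 := aux_upperT A L hL u
    have b3 := aux_upper A L hL h
    have b4 := aux_nonneg (A *ᵥ (x - y))
    rw [← hu] at b0 b1
    rw [← hh] at b2
    have c2 : h ⬝ᵥ h ≤ L ^ 2 * (d ⬝ᵥ d) := by nlinarith [mul_le_mul_of_nonneg_left b1 hL0]
    have c3 : (A *ᵥ h) ⬝ᵥ (A *ᵥ h) ≤ L ^ 3 * (d ⬝ᵥ d) := by
      nlinarith [mul_le_mul_of_nonneg_left c2 hL0]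
    unfold merit
    rw [s1] at h1
    rw [s2, s3]
    rw [s4] at g2
    have f : (ρ/2) * (d ⬝ᵥ d + 2 * (1/ρ * (u ⬝ᵥ u)) + 1/ρ * (1/ρ * (h ⬝ᵥ h)))
        - 1/2 * (u ⬝ᵥ u + 2 * (1/ρ * (h ⬝ᵥ h)) + 1/ρ * (1/ρ * ((A *ᵥ h) ⬝ᵥ (A *ᵥ h))))
        - (ρ/2) * (1/ρ * (1/ρ * (h ⬝ᵥ h)))
        = (ρ/2) * (d ⬝ᵥ d) + 1/2 * (u ⬝ᵥ u) - 1/ρ * (h ⬝ᵥ h)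
          - 1/(2*ρ^2) * ((A *ᵥ h) ⬝ᵥ (A *ᵥ h)) := by
      field_simp
      ring
    have k : ((μ + ρ)/2 - (2 * ρ * L ^ 2 + L ^ 3) / (2 * ρ ^ 2)) * (d ⬝ᵥ d)
        = (ρ/2) * (d ⬝ᵥ d) + 1/2 * (μ * (d ⬝ᵥ d)) - 1/ρ * (L ^ 2 * (d ⬝ᵥ d))
          - 1/(2*ρ^2) * (L ^ 3 * (d ⬝ᵥ d)) := by
      field_simp
      ring
    have m2 := mul_le_mul_of_nonneg_left c2 (show 0 ≤ 1/ρ by positivity)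
    have m3 := mul_le_mul_of_nonneg_left c3 (show 0 ≤ 1/(2*ρ^2) by positivity)
    linarith
  · intro hgt
    have e : (μ + ρ)/2 - (2 * ρ * L ^ 2 + L ^ 3) / (2 * ρ ^ 2)
        = (μ - (L ^ 3 + 2 * L ^ 2 * ρ - ρ ^ 3) / ρ ^ 2) / 2 := by
      field_simp
      ring
    rw [e]
    linarith

/-- Sufficient descent of the merit function along one ADMM step,
where `μ = λ_min(AᵀA)`, `L_g = λ_max(AᵀA)`, and `λ = Aᵀ(Ay − b)`:
`L_m(x⁺, y⁺) ≤ L_m(x, y) − κ̃₁ ‖y⁺ − y‖₂²` with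
`κ̃₁ = (μ + ρ)/2 − (2ρL_g² + L_g³)/(2ρ²)`, which is positive whenever
`μ > (L_g³ + 2L_g²ρ − ρ³)/ρ²`. -/
theorem merit_sufficient_descent (m n : ℕ) (A : Matrix (Fin m) (Fin n) ℝ)
    (b : Fin m → ℝ) (ζ ρ μ L : ℝ) (hζ : 0 < ζ) (hρ : 0 < ρ)
    (hμ : IsLeast (eigSet (A.transpose * A)) μ)
    (hL : IsGreatest (eigSet (A.transpose * A)) L)
    (x y lam xp yp lamp : Fin n → ℝ)
    (hlam : lam = A.transpose.mulVec (A.mulVec y - b))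
    (hxp : ∀ x' : Fin n → ℝ,
      Phi ζ xp + (ρ/2) * ∑ i, (xp i - y i + lam i / ρ) ^ 2
        ≤ Phi ζ x' + (ρ/2) * ∑ i, (x' i - y i + lam i / ρ) ^ 2)
    (hyp : ∀ y' : Fin n → ℝ,
      gobj A b yp + (ρ/2) * ∑ i, (yp i - xp i - lam i / ρ) ^ 2
        ≤ gobj A b y' + (ρ/2) * ∑ i, (y' i - xp i - lam i / ρ) ^ 2)
    (hlamp : lamp = lam + ρ • (xp - yp)) :
    merit A b ζ ρ xp yp
        ≤ merit A b ζ ρ x y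
          - ((μ + ρ)/2 - (2 * ρ * L ^ 2 + L ^ 3) / (2 * ρ ^ 2)) * ∑ i, (yp i - y i) ^ 2 ∧
      (μ > (L ^ 3 + 2 * L ^ 2 * ρ - ρ ^ 3) / ρ ^ 2 →
        0 < (μ + ρ)/2 - (2 * ρ * L ^ 2 + L ^ 3) / (2 * ρ ^ 2)) := by
  exact aux_main m n A b ζ ρ μ L hζ hρ hμ hL x y lam xp yp lamp hlam hxp hyp hlamp
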